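/- Let d ≥ 3 and G_n = Z_n^d the discrete torus, and set g_c(x,y;Z_n^d) = Σ_{t=0}^{c·T_mix(G_n)} p^t(x,y;Z_n^d). Then for each c > 1, lim_{n→∞} (1/h_d(n)) Σ_{x,y ∈ V_n} ( f_{n,c}(x,y) − G(0;Z^d)^{-1} g_c(x,y;Z_n^d) )^2 = 0, where h_3(n) = n^4, h_4(n) = n^4 log n, h_d(n) = n^d for d ≥ 5, and G(x;Z^d) = Σ_{t=0}^∞ p^t(0,x;Z^d) is the Green's function of lazy simple random walk on Z^d. -/

import Mathlib

open MeasureTheory ProbabilityTheory Filter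

attribute [local instance] Classical.propDecidable

noncomputable section

namespace RWPaint

variable {V : Type*} [Fintype V]

/-- The degree of a vertex. -/
def deg (G : SimpleGraph V) (x : V) : ℕ := (Finset.univ.filter fun y => G.Adj x y).card

/-- One-step transition kernel of the lazy random walk on a finite graph:
holding probability `1/2`, otherwise a uniformly chosen neighbour. -/
def K (G : SimpleGraph V) (x y : V) : ℝ :=
  if x = y then (if deg G x = 0 then 1 else 1 / 2)
  else if G.Adj x y then 1 / (2 * (deg G x : ℝ)) else 0

/-- The `t`-step transition kernel. -/
def Kpow (G : SimpleGraph V) : ℕ → V → V → ℝ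
  | 0 => fun x y => if x = y then 1 else 0
  | t + 1 => fun x y => ∑ z, Kpow G t x z * K G z y

/-- The uniform (stationary) probability of a single vertex. -/
def unif (V : Type*) [Fintype V] : ℝ := (Fintype.card V : ℝ)⁻¹

/-- The uniform mixing time. -/
def Tmix (G : SimpleGraph V) : ℕ :=
  sInf {t : ℕ | ∀ x y : V, |Kpow G t x y / unif V - 1| ≤ 1 / 4}

/-- The Green's function `g(x,y) = ∑_{t=0}^{Tmix} p^t(x,y)`. -/
def green (G : SimpleGraph V) (x y : V) : ℝ :=
  ∑ t ∈ Finset.range (Tmix G + 1), Kpow G t x y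

/-- The kernel killed on (entering) the set `S`. -/
def Kkill (G : SimpleGraph V) (S : Finset V) (x y : V) : ℝ :=
  if y ∈ S then 0 else K G x y

/-- Powers of the killed kernel. -/
def KkillPow (G : SimpleGraph V) (S : Finset V) : ℕ → V → V → ℝ
  | 0 => fun x y => if x = y then 1 else 0
  | t + 1 => fun x y => ∑ z, KkillPow G S t x z * Kkill G S z y

/-- `P_x[τ(S) ≤ T]`, the probability that the lazy walk started at `x` visits `S`
by time `T`. -/
def hitBy (G : SimpleGraph V) (S : Finset V) (x : V) (T : ℕ) : ℝ :=
  if x ∈ S then 1 else 1 - ∑ z, KkillPow G S T x z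

/-- `f_{n,c}(x,y) = P_x[τ(y) ≤ c T_mix]`. -/
def fnc (G : SimpleGraph V) (c : ℝ) (x y : V) : ℝ :=
  hitBy G {y} x ⌊c * (Tmix G : ℝ)⌋₊

/-- `f̄_{n,c} = ∑_y f_{n,c}(x,y) π(y)` (averaged also over `x`; by vertex
transitivity this agrees with the value for any fixed `x`). -/
def fbar (G : SimpleGraph V) (c : ℝ) : ℝ :=
  (∑ x : V, ∑ y : V, fnc G c x y) / (Fintype.card V : ℝ) ^ 2

/-- `F_{n,c} = ∑_{x,y} (f_{n,c}(x,y) - f̄_{n,c})^2`. -/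
def Fquad (G : SimpleGraph V) (c : ℝ) : ℝ :=
  ∑ x : V, ∑ y : V, (fnc G c x y - fbar G c) ^ 2

/-- `Γ_n = c₀ T_mix log |V|`. -/
def gammaTime (G : SimpleGraph V) (c₀ : ℝ) : ℕ :=
  ⌊c₀ * (Tmix G : ℝ) * Real.log (Fintype.card V)⌋₊

/-- `P_x[X_t = z | τ(y) ≥ t]` as a combinatorial formula (meaningful for
`x ≠ y` and `t ≥ 1`). -/
def condAtProb (G : SimpleGraph V) (y x z : V) (t : ℕ) : ℝ :=
  (∑ w, KkillPow G {y} (t - 1) x w * K G w z) / (∑ w, KkillPow G {y} (t - 1) x w)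

/-- `∑_{t=0}^{c T_mix} p^t(x,y)`. -/
def greenC (G : SimpleGraph V) (c : ℝ) (x y : V) : ℝ :=
  ∑ t ∈ Finset.range (⌊c * (Tmix G : ℝ)⌋₊ + 1), Kpow G t x y

/-- A graph is vertex transitive if its automorphism group acts transitively. -/
def IsVertexTransitive (G : SimpleGraph V) : Prop :=
  ∀ x y : V, ∃ e : G ≃g G, e x = y

/-- The probability of a trajectory prefix for the lazy walk with initial
distribution `init`. -/
def walkP (G : SimpleGraph V) (init : V → ℝ) (n : ℕ) (v : ℕ → V) : ℝ :=
  init (v 0) * ∏ i ∈ Finset.range n, K G (v i) (v (i + 1))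

/-- Point mass initial distribution. -/
def delta (x : V) : V → ℝ := fun y => if y = x then 1 else 0

/-- Uniform initial distribution. -/
def uinit (V : Type*) [Fintype V] : V → ℝ := fun _ => (Fintype.card V : ℝ)⁻¹

/-- `X₁, X₂` are independent lazy random walks on `G` with initial
distributions `init₁, init₂`, defined on the probability space `(Ω, P)`:
all finite-dimensional distributions factorize as products of trajectory-prefix
probabilities. -/
structure IsWalkPair {Ω : Type*} [MeasurableSpace Ω] (G : SimpleGraph V) (P : Measure Ω)
    (X₁ X₂ : ℕ → Ω → V) (init₁ init₂ : V → ℝ) : Prop where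
  meas₁ : ∀ (t : ℕ) (x : V), MeasurableSet {ω | X₁ t ω = x}
  meas₂ : ∀ (t : ℕ) (x : V), MeasurableSet {ω | X₂ t ω = x}
  law : ∀ (n : ℕ) (v w : ℕ → V),
    (P {ω | (∀ i ≤ n, X₁ i ω = v i) ∧ ∀ i ≤ n, X₂ i ω = w i}).toReal
      = walkP G init₁ n v * walkP G init₂ n w

/-- `X₁, X₂` are independent stationary lazy random walks on `G`, together with
a family `ξ` of independent fair coins (one per vertex, used to break ties),
all defined on the probability space `(Ω, P)`. -/
structure IsPaintSetup {Ω : Type*} [MeasurableSpace Ω] (G : SimpleGraph V) (P : Measure Ω)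
    (X₁ X₂ : ℕ → Ω → V) (ξ : V → Ω → Bool) : Prop where
  meas₁ : ∀ (t : ℕ) (x : V), MeasurableSet {ω | X₁ t ω = x}
  meas₂ : ∀ (t : ℕ) (x : V), MeasurableSet {ω | X₂ t ω = x}
  measξ : ∀ x : V, MeasurableSet {ω | ξ x ω = true}
  law : ∀ (n : ℕ) (v w : ℕ → V) (b : V → Bool),
    (P {ω | ((∀ i ≤ n, X₁ i ω = v i) ∧ ∀ i ≤ n, X₂ i ω = w i) ∧ ∀ x, ξ x ω = b x}).toReal
      = walkP G (uinit V) n v * walkP G (uinit V) n w * (1 / 2) ^ Fintype.card V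

/-- The hitting time `τ(x)` of a vertex `x` (with value `⊤` if `x` is never visited). -/
def hitTime {Ω : Type*} (X : ℕ → Ω → V) (x : V) (ω : Ω) : ℕ∞ :=
  ⨅ (s : ℕ) (_ : X s ω = x), (s : ℕ∞)

/-- `τ(x,y) = τ(x) ⊓ τ(y)`. -/
def hitTime2 {Ω : Type*} (X : ℕ → Ω → V) (x y : V) (ω : Ω) : ℕ∞ :=
  min (hitTime X x ω) (hitTime X y ω)

/-- `|𝒜₁|`: the number of vertices first visited by `X₁` (ties broken by the coins `ξ`). -/
def paintedCount {Ω : Type*} (X₁ X₂ : ℕ → Ω → V) (ξ : V → Ω → Bool) (ω : Ω) : ℕ :=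
  Nat.card {x : V // hitTime X₁ x ω < hitTime X₂ x ω ∨
    (hitTime X₁ x ω = hitTime X₂ x ω ∧ ξ x ω = true)}

/-- The event `H(x,y) = {τ₁(x) < min(τ₁(y), τ₂(x), τ₂(y))}`. -/
def Hevent {Ω : Type*} (X₁ X₂ : ℕ → Ω → V) (x y : V) : Set Ω :=
  {ω | hitTime X₁ x ω < min (hitTime X₁ y ω) (min (hitTime X₂ x ω) (hitTime X₂ y ω))}

/-- `Y₂ = X₂(τ₁(x,y))`. -/
def Ytwo {Ω : Type*} (X₁ X₂ : ℕ → Ω → V) (x y : V) (ω : Ω) : V :=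
  X₂ (hitTime2 X₁ x y ω).toNat ω

/-- `π̃(z;x,y) = P[X₂(τ₁(x,y)) = z | H(x,y)]`. -/
def pitilde {Ω : Type*} [MeasurableSpace Ω] (P : Measure Ω) (X₁ X₂ : ℕ → Ω → V) (x y z : V) : ℝ :=
  (P (Hevent X₁ X₂ x y ∩ {ω | Ytwo X₁ X₂ x y ω = z})).toReal
    / (P (Hevent X₁ X₂ x y)).toReal

/-- The event `A(x,y) = {τ₁(x,y) ≥ τ₂(x,y) > τ₁(x,y) - Γ, τ₁(x) < τ₁(y)}`. -/
def Aevent {Ω : Type*} (X₁ X₂ : ℕ → Ω → V) (x y : V) (Γ : ℕ) : Set Ω :=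
  {ω | hitTime2 X₂ x y ω ≤ hitTime2 X₁ x y ω ∧
    hitTime2 X₁ x y ω - (Γ : ℕ∞) < hitTime2 X₂ x y ω ∧
    hitTime X₁ x ω < hitTime X₁ y ω}

/-- Conditional probability `P[A | B]`. -/
def condGiven {Ω : Type*} [MeasurableSpace Ω] (P : Measure Ω) (A B : Set Ω) : ℝ :=
  (P (A ∩ B)).toReal / (P B).toReal

/-- Assumption 1 of the paper. -/
structure Assumption1 (V : ℕ → Type*) [∀ n, Fintype (V n)]
    (G : ∀ n, SimpleGraph (V n)) : Prop where
  conn : ∀ n, (G n).Connected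
  vt : ∀ n, IsVertexTransitive (G n)
  card_top : Tendsto (fun n => Fintype.card (V n)) atTop atTop
  tmix_small : Tendsto (fun n =>
    (Tmix (G n) : ℝ) * (Real.log (Fintype.card (V n))) ^ 2 / (Fintype.card (V n) : ℝ))
    atTop (nhds 0)
  tmix_top : Tendsto (fun n => Tmix (G n)) atTop atTop
  green_sq_small : ∃ ε : ℕ → ℝ, Tendsto ε atTop (nhds 0) ∧
    ∀ n, ∀ x : V n, ∑ y ∈ Finset.univ.erase x, (green (G n) x y) ^ 2
      ≤ ε n * (Tmix (G n) : ℝ) / Real.log (Fintype.card (V n))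
  hit_miss : ∃ ρ : ℝ, ρ < 1 ∧ ∀ n, ∀ x y z : V n, x ≠ y → x ≠ z → y ≠ z →
    hitBy (G n) {y, z} x (Tmix (G n)) ≤ ρ

/-- The discrete torus `ℤ_n^d`. -/
def torus (d n : ℕ) : SimpleGraph (Fin d → ZMod n) where
  Adj x y := x ≠ y ∧ ∃ i, y - x = Pi.single i 1 ∨ x - y = Pi.single i 1
  symm := by
    constructor
    rintro x y ⟨hne, i, h | h⟩
    · exact ⟨hne.symm, i, Or.inr h⟩
    · exact ⟨hne.symm, i, Or.inl h⟩
  loopless := ⟨fun x h => h.1 rfl⟩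

/-- The hypercube `ℤ_2^n`. -/
def hypercube (n : ℕ) : SimpleGraph (Fin n → Bool) where
  Adj x y := x ≠ y ∧ ∃ i, ∀ j, j ≠ i → x j = y j
  symm := by
    constructor
    rintro x y ⟨hne, i, h⟩
    exact ⟨hne.symm, i, fun j hj => (h j hj).symm⟩
  loopless := ⟨fun x h => h.1 rfl⟩

/-- The Cayley graph of the symmetric group `S_n` generated by the transpositions. -/
def transpositionGraph (n : ℕ) : SimpleGraph (Equiv.Perm (Fin n)) where
  Adj σ τ := (σ * τ⁻¹).IsSwap
  symm := by
    constructor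
    rintro σ τ ⟨a, b, hab, h⟩
    exact ⟨a, b, hab, by rw [show τ * σ⁻¹ = (σ * τ⁻¹)⁻¹ by group, h, Equiv.swap_inv]⟩
  loopless := by
    constructor
    intro σ h
    obtain ⟨a, b, hab, h⟩ := h
    rw [mul_inv_cancel] at h
    exact hab (by simpa [Equiv.swap_apply_left] using Equiv.ext_iff.mp h a)

/-- One-step kernel of the lazy simple random walk on `ℤ^d`. -/
def KZ (d : ℕ) (x y : Fin d → ℤ) : ℝ :=
  if x = y then 1 / 2
  else if ∃ i, y - x = Pi.single i 1 ∨ x - y = Pi.single i 1 then 1 / (4 * d) else 0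

/-- `t`-step kernel of the lazy simple random walk on `ℤ^d`. -/
def KZpow (d : ℕ) : ℕ → (Fin d → ℤ) → (Fin d → ℤ) → ℝ
  | 0 => fun x y => if x = y then 1 else 0
  | t + 1 => fun x y => ∑' z, KZpow d t x z * KZ d z y

/-- The Green's function `G(x; ℤ^d) = ∑_{t=0}^∞ p^t(0,x)` of the lazy walk on `ℤ^d`. -/
def greenZ (d : ℕ) (x : Fin d → ℤ) : ℝ := ∑' t : ℕ, KZpow d t 0 x

/-- `α_d` for `d ≥ 5`. -/
def alphaHigh (d : ℕ) : ℝ := (∑' y : Fin d → ℤ, (greenZ d y) ^ 2) / (greenZ d 0) ^ 2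

/-- The normalization `h_d(n)`. -/
def hfun (d n : ℕ) : ℝ :=
  if d = 3 then (n : ℝ) ^ 4
  else if d = 4 then (n : ℝ) ^ 4 * Real.log n
  else (n : ℝ) ^ d

/-- Matrix powers of an abstract kernel. -/
def mpow (p : V → V → ℝ) : ℕ → V → V → ℝ
  | 0 => fun x y => if x = y then 1 else 0
  | t + 1 => fun x y => ∑ z, mpow p t x z * p z y

/-- Total variation distance between two (probability) vectors. -/
def tvDist (μ ν : V → ℝ) : ℝ := (1 / 2) * ∑ x, |μ x - ν x|


section gen
variable {V : Type*} [Fintype V]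

lemma K_nonneg (G : SimpleGraph V) (x y : V) : 0 ≤ K G x y := by
  unfold K
  split_ifs <;> positivity

lemma Kpow_nonneg (G : SimpleGraph V) (t : ℕ) (x y : V) : 0 ≤ Kpow G t x y := by
  induction t generalizing y with
  | zero => simp only [Kpow]; split_ifs <;> norm_num
  | succ t ih => exact Finset.sum_nonneg fun z _ => mul_nonneg (ih z) (K_nonneg G z y)

lemma KkillPow_nonneg (G : SimpleGraph V) (S : Finset V) (t : ℕ) (x y : V) :
    0 ≤ KkillPow G S t x y := by
  induction t generalizing y with
  | zero => simp only [KkillPow]; split_ifs <;> norm_num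
  | succ t ih =>
    refine Finset.sum_nonneg fun z _ => mul_nonneg (ih z) ?_
    unfold Kkill
    split_ifs
    · exact le_rfl
    · exact K_nonneg G z y

/-- probability of hitting `y` at time `s+1` -/
def hs (G : SimpleGraph V) (y x : V) (s : ℕ) : ℝ := ∑ z, KkillPow G {y} s x z * K G z y

lemma hs_nonneg (G : SimpleGraph V) (y x : V) (s : ℕ) : 0 ≤ hs G y x s :=
  Finset.sum_nonneg fun z _ => mul_nonneg (KkillPow_nonneg G _ s x z) (K_nonneg G z y)

lemma Kkill_sum (G : SimpleGraph V) (hK : ∀ x, ∑ y, K G x y = 1) (y w : V) :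
    ∑ z, Kkill G {y} w z = 1 - K G w y := by
  have : ∀ z, Kkill G {y} w z = K G w z - if z = y then K G w y else 0 := by
    intro z
    unfold Kkill
    by_cases h : z = y
    · subst h; simp
    · simp [h]
  simp only [this, Finset.sum_sub_distrib, hK]
  simp

lemma kill_mass (G : SimpleGraph V) (hK : ∀ x, ∑ y, K G x y = 1) (y x : V) (T : ℕ) :
    1 - ∑ z, KkillPow G {y} T x z = ∑ s ∈ Finset.range T, hs G y x s := by
  induction T with
  | zero => simp [KkillPow]
  | succ t ih =>
    rw [Finset.sum_range_succ, ← ih]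
    have : ∑ z, KkillPow G {y} (t+1) x z = ∑ z, KkillPow G {y} t x z - hs G y x t := by
      simp only [KkillPow]
      rw [Finset.sum_comm]
      simp only [← Finset.mul_sum, Kkill_sum G hK, hs, mul_sub, mul_one, Finset.sum_sub_distrib]
    rw [this]; ring

lemma Kpow_decomp (G : SimpleGraph V) (y x w : V) (t : ℕ) :
    Kpow G t x w = KkillPow G {y} t x w
      + ∑ s ∈ Finset.range t, hs G y x s * Kpow G (t - 1 - s) y w := by
  induction t generalizing w with
  | zero => simp [Kpow, KkillPow]
  | succ t ih =>
    have h1 : Kpow G (t+1) x w = ∑ z, KkillPow G {y} t x z * K G z w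
        + ∑ s ∈ Finset.range t, hs G y x s * Kpow G (t - s) y w := by
      simp only [Kpow]
      simp only [ih, add_mul, Finset.sum_add_distrib]
      congr 1
      simp only [Finset.sum_mul]
      rw [Finset.sum_comm]
      refine Finset.sum_congr rfl fun s hs' => ?_
      have : t - s = (t - 1 - s) + 1 := by have := Finset.mem_range.1 hs'; omega
      rw [this]
      simp only [Kpow, Finset.mul_sum, mul_assoc]
    rw [h1, Finset.sum_range_succ]
    simp only [add_tsub_cancel_right, tsub_self, Kpow, KkillPow, Kkill]
    by_cases h : w = y
    · subst h; simp [hs]; ring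
    · simp [h, Ne.symm h]

/-- truncated Green function -/
def gs (G : SimpleGraph V) (T : ℕ) (x y : V) : ℝ := ∑ t ∈ Finset.range (T + 1), Kpow G t x y

lemma gs_mono (G : SimpleGraph V) {S T : ℕ} (h : S ≤ T) (x y : V) : gs G S x y ≤ gs G T x y :=
  Finset.sum_le_sum_of_subset_of_nonneg (Finset.range_subset_range.2 (by omega))
    fun _ _ _ => Kpow_nonneg G _ x y

lemma gs_nonneg (G : SimpleGraph V) (T : ℕ) (x y : V) : 0 ≤ gs G T x y :=
  Finset.sum_nonneg fun _ _ => Kpow_nonneg G _ x y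

lemma one_le_gs (G : SimpleGraph V) (T : ℕ) (x : V) : 1 ≤ gs G T x x := by
  refine le_trans ?_ (gs_mono G (Nat.zero_le T) x x)
  simp [gs, Kpow]

lemma Kkill_target (G : SimpleGraph V) {x y : V} (h : x ≠ y) (t : ℕ) : KkillPow G {y} t x y = 0 := by
  cases t with
  | zero => simp [KkillPow, h]
  | succ t => simp [KkillPow, Kkill]

lemma gs_eq (G : SimpleGraph V) {x y : V} (h : x ≠ y) (T : ℕ) :
    gs G T x y = ∑ s ∈ Finset.range T, hs G y x s * ∑ u ∈ Finset.range (T - s), Kpow G u y y := by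
  induction T with
  | zero => simp [gs, Kpow, h]
  | succ T ih =>
    have h1 : gs G (T+1) x y = gs G T x y + Kpow G (T+1) x y := by
      simp [gs, Finset.sum_range_succ]
    rw [h1, ih, Kpow_decomp G y x y (T+1), Kkill_target G h, zero_add]
    have h2 : ∑ s ∈ Finset.range T, hs G y x s * ∑ u ∈ Finset.range (T - s), Kpow G u y y
        = ∑ s ∈ Finset.range (T+1), hs G y x s * ∑ u ∈ Finset.range (T - s), Kpow G u y y := by
      rw [Finset.sum_range_succ _ T]; simp
    rw [h2, ← Finset.sum_add_distrib]
    refine Finset.sum_congr rfl fun s hs' => ?_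
    have : T + 1 - s = (T - s) + 1 := by have := Finset.mem_range.1 hs'; omega
    rw [this, Finset.sum_range_succ]
    simp only [add_tsub_cancel_right]
    ring

lemma hit_eq (G : SimpleGraph V) (hK : ∀ x, ∑ y, K G x y = 1) {x y : V} (h : x ≠ y) (T : ℕ) :
    hitBy G {y} x T = ∑ s ∈ Finset.range T, hs G y x s := by
  simp [hitBy, h, kill_mass G hK]

lemma hit_self (G : SimpleGraph V) (y : V) (T : ℕ) : hitBy G {y} y T = 1 := by simp [hitBy]

lemma hit_upper (G : SimpleGraph V) (hK : ∀ x, ∑ y, K G x y = 1) (x y : V) (T : ℕ) :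
    gs G T x y ≤ hitBy G {y} x T * gs G T y y := by
  by_cases h : x = y
  · subst h; simp [hit_self]
  · rw [hit_eq G hK h, gs_eq G h, Finset.sum_mul]
    refine Finset.sum_le_sum fun s _ => mul_le_mul_of_nonneg_left ?_ (hs_nonneg G y x s)
    exact Finset.sum_le_sum_of_subset_of_nonneg (Finset.range_subset_range.2 (by omega))
      fun _ _ _ => Kpow_nonneg G _ y y

lemma hit_lower (G : SimpleGraph V) (hK : ∀ x, ∑ y, K G x y = 1) (x y : V) (T S : ℕ) :
    hitBy G {y} x T * gs G S y y ≤ gs G (T + S) x y := by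
  by_cases h : x = y
  · subst h; rw [hit_self, one_mul]; exact gs_mono G (by omega) x x
  · rw [hit_eq G hK h, gs_eq G h, Finset.sum_mul]
    refine le_trans (Finset.sum_le_sum (g := fun s => hs G y x s *
      ∑ u ∈ Finset.range (T + S - s), Kpow G u y y) fun s hs' => 
        mul_le_mul_of_nonneg_left ?_ (hs_nonneg G y x s)) ?_
    · have := Finset.mem_range.1 hs'
      exact Finset.sum_le_sum_of_subset_of_nonneg (Finset.range_subset_range.2 (by omega))
        fun _ _ _ => Kpow_nonneg G _ y y
    · exact Finset.sum_le_sum_of_subset_of_nonneg (Finset.range_subset_range.2 (by omega))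
        fun s _ _ => mul_nonneg (hs_nonneg G y x s)
          (Finset.sum_nonneg fun _ _ => Kpow_nonneg G _ y y)

lemma hit_nonneg (G : SimpleGraph V) (hK : ∀ x, ∑ y, K G x y = 1) (x y : V) (T : ℕ) :
    0 ≤ hitBy G {y} x T := by
  by_cases h : x = y
  · subst h; simp [hit_self]
  · rw [hit_eq G hK h]; exact Finset.sum_nonneg fun s _ => hs_nonneg G y x s

lemma Kpow_add (G : SimpleGraph V) (s t : ℕ) (x y : V) :
    Kpow G (s + t) x y = ∑ z, Kpow G s x z * Kpow G t z y := by
  induction t generalizing y with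
  | zero => simp [Kpow]
  | succ t ih =>
    rw [← add_assoc]
    simp only [Kpow, ih, Finset.sum_mul, Finset.mul_sum]
    rw [Finset.sum_comm]
    simp only [mul_assoc]

lemma Kpow_row (G : SimpleGraph V) (hK : ∀ x, ∑ y, K G x y = 1) (t : ℕ) (x : V) :
    ∑ y, Kpow G t x y = 1 := by
  induction t with
  | zero => simp [Kpow]
  | succ t ih =>
    simp only [Kpow]
    rw [Finset.sum_comm]
    simp only [← Finset.mul_sum, hK, mul_one, ih]

lemma Kpow_sup_mono (G : SimpleGraph V) (hK : ∀ x, ∑ y, K G x y = 1) (t s : ℕ) (B : ℝ)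
    (hB : ∀ x y, Kpow G t x y ≤ B) (x y : V) : Kpow G (s + t) x y ≤ B := by
  rw [Kpow_add]
  calc _ ≤ ∑ z, Kpow G s x z * B :=
        Finset.sum_le_sum fun z _ => mul_le_mul_of_nonneg_left (hB z y) (Kpow_nonneg G s x z)
    _ = B := by rw [← Finset.sum_mul, Kpow_row G hK, one_mul]

/-- the deterministic comparison estimate -/
lemma compare (G : SimpleGraph V) (hK : ∀ x, ∑ y, K G x y = 1) (x y : V) (T S : ℕ) (g ε B : ℝ)
    (hg : 1 ≤ g) (hε : 0 ≤ ε) (hε1 : ε ≤ 1)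
    (hS : g - ε ≤ gs G S y y) (hT : gs G T y y ≤ g + 3 * ε) (hB : 0 ≤ B)
    (ht : ∀ t, T ≤ t → Kpow G t x y ≤ B) :
    |hitBy G {y} x T - g⁻¹ * gs G T x y| ≤ 3 * ε * gs G T x y + 4 * S * B := by
  have h1 := hit_upper G hK x y T
  have h2 := hit_lower G hK x y T S
  have h3 : gs G (T + S) x y ≤ gs G T x y + S * B := by
    unfold gs
    rw [show T + S + 1 = (T + 1) + S by ring, Finset.sum_range_add]
    gcongr
    calc _ ≤ ∑ i ∈ Finset.range S, B := Finset.sum_le_sum fun i _ => ht _ (by omega)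
      _ = _ := by simp
  have h4 := one_le_gs G S y
  have h5 := hit_nonneg G hK x y T
  have h6 := gs_nonneg G T x y
  set f := hitBy G {y} x T
  set q := gs G T x y
  set b := gs G S y y
  set a := gs G T y y
  have hSB : 0 ≤ S * B := by positivity
  have hf : f ≤ q + S * B := by nlinarith
  have hg0 : 0 < g := by linarith
  have hgi : g⁻¹ ≤ 1 := inv_le_one_of_one_le₀ hg
  have hgi0 : 0 < g⁻¹ := by positivity
  have hgg : g⁻¹ * g = 1 := inv_mul_cancel₀ hg0.ne'
  -- q ≤ f (g + 3 ε)
  have e1 : g⁻¹ * q ≤ f + 3 * ε * f := by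
    have : q ≤ f * (g + 3 * ε) := h1.trans (mul_le_mul_of_nonneg_left hT h5)
    calc g⁻¹ * q ≤ g⁻¹ * (f * (g + 3 * ε)) := by gcongr
      _ = f + g⁻¹ * (3 * ε * f) := by linear_combination f * hgg
      _ ≤ f + 1 * (3 * ε * f) := by gcongr
      _ = _ := by ring
  -- f b ≤ q + SB
  have e2 : f ≤ g⁻¹ * q + ε * f + S * B := by
    have : f * (g - ε) ≤ q + S * B := (mul_le_mul_of_nonneg_left hS h5).trans (h2.trans h3)
    have h7 : g⁻¹ * (f * (g - ε)) ≤ g⁻¹ * (q + S * B) := by gcongr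
    have h8 : g⁻¹ * (f * (g - ε)) = f - g⁻¹ * (ε * f) := by linear_combination f * hgg
    have h9 : g⁻¹ * (ε * f) ≤ 1 * (ε * f) := by gcongr
    have h10 : g⁻¹ * (S * B) ≤ 1 * (S * B) := by gcongr
    linarith [mul_add g⁻¹ q (S * B)]
  have e3 : ε * f ≤ ε * q + S * B := by nlinarith
  have e4 : 0 ≤ ε * q := by positivity
  rw [abs_le]
  constructor <;> linarith
end gen

section tor

lemma single_cases {R : Type*} [CommRing R] (h1 : (1:R) ≠ 0) {d : ℕ} (i j : Fin d) :
    (Pi.single i (1:R) : Fin d → R) = Pi.single j 1 ↔ i = j := by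
  constructor
  · intro h
    by_contra hij
    have := congrFun h i
    rw [Pi.single_eq_same, Pi.single_eq_of_ne hij] at this
    exact h1 this
  · rintro rfl; rfl

lemma single_neg_ne {R : Type*} [CommRing R] (h1 : (1:R) ≠ 0) (h2 : (1:R) ≠ -1) {d : ℕ}
    (i j : Fin d) : (Pi.single i (1:R) : Fin d → R) ≠ - Pi.single j 1 := by
  intro h
  have := congrFun h i
  rw [Pi.single_eq_same, Pi.neg_apply] at this
  by_cases hij : i = j
  · subst hij; rw [Pi.single_eq_same] at this; exact h2 this
  · rw [Pi.single_eq_of_ne hij, neg_zero] at this; exact h1 this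

lemma adj_ind {R : Type*} [CommRing R] (h1 : (1:R) ≠ 0) (h2 : (1:R) ≠ -1) {d : ℕ}
    (z y : Fin d → R) :
    (if ∃ i, y - z = Pi.single i 1 ∨ z - y = Pi.single i 1 then (1:ℝ) else 0)
      = ∑ i, ((if z = y - Pi.single i 1 then (1:ℝ) else 0)
        + (if z = y + Pi.single i 1 then (1:ℝ) else 0)) := by
  split_ifs with h
  · obtain ⟨i, h | h⟩ := h
    · have hz : z = y - Pi.single i 1 := by rw [← h]; abel
      have e1 : ∀ j, (z = y - Pi.single j 1) ↔ i = j := by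
        intro j; rw [hz, sub_right_inj, single_cases h1]
      have e2 : ∀ j, ¬ (z = y + Pi.single j 1) := by
        intro j hh
        rw [hz, sub_eq_add_neg, add_right_inj] at hh
        exact single_neg_ne h1 h2 j i hh.symm
      simp [e1, e2]
    · have hz : z = y + Pi.single i 1 := by rw [← h]; abel
      have e1 : ∀ j, (z = y + Pi.single j 1) ↔ i = j := by
        intro j; rw [hz, add_right_inj, single_cases h1]
      have e2 : ∀ j, ¬ (z = y - Pi.single j 1) := by
        intro j hh
        rw [hz, sub_eq_add_neg, add_right_inj] at hh
        exact single_neg_ne h1 h2 i j hh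
      simp [e1, e2]
  · push Not at h
    symm
    refine Finset.sum_eq_zero fun i _ => ?_
    have e1 : ¬ (z = y - Pi.single i 1) := by
      intro hh; exact (h i).1 (by rw [hh]; abel)
    have e2 : ¬ (z = y + Pi.single i 1) := by
      intro hh; exact (h i).2 (by rw [hh]; abel)
    simp [e1, e2]

lemma not_nb {R : Type*} [CommRing R] (h1 : (1:R) ≠ 0) {d : ℕ} (y : Fin d → R) :
    ¬ ∃ i, y - y = Pi.single i 1 ∨ y - y = Pi.single i 1 := by
  rintro ⟨i, h⟩
  rw [or_self, sub_self] at h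
  have := congrFun h i
  rw [Pi.single_eq_same] at this
  exact h1 this.symm

lemma zmod_ne {N : ℕ} (hN : 3 ≤ N) : (1 : ZMod N) ≠ 0 ∧ (1 : ZMod N) ≠ -1 := by
  have : Fact (1 < N) := ⟨by omega⟩
  have : Fact (2 < N) := ⟨by omega⟩
  exact ⟨one_ne_zero, (ZMod.neg_one_ne_one).symm⟩

lemma torus_adj {d N : ℕ} (hN : 3 ≤ N) (x y : Fin d → ZMod N) :
    (torus d N).Adj x y ↔ ∃ i, y - x = Pi.single i 1 ∨ x - y = Pi.single i 1 := by
  constructor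
  · exact fun h => h.2
  · intro h
    refine ⟨?_, h⟩
    rintro rfl
    exact not_nb (zmod_ne hN).1 x h

lemma torus_deg {d N : ℕ} [NeZero N] (hN : 3 ≤ N) (x : Fin d → ZMod N) : deg (torus d N) x = 2 * d := by
  have : ((deg (torus d N) x : ℕ) : ℝ) = 2 * d := by
    unfold deg
    rw [Finset.card_filter]
    push_cast
    have : ∀ y, (if (torus d N).Adj x y then (1:ℝ) else 0) = ∑ i, ((if y = x + Pi.single i 1 then (1:ℝ) else 0)
        + (if y = x - Pi.single i 1 then (1:ℝ) else 0)) := by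
      intro y
      have hA := adj_ind (zmod_ne hN).1 (zmod_ne hN).2 x y
      simp only [← torus_adj hN] at hA
      rw [hA]
      refine Finset.sum_congr rfl fun i _ => ?_
      have e1 : (x = y - Pi.single i 1) ↔ (y = x + Pi.single i 1) := by
        constructor <;> (rintro rfl; abel)
      have e2 : (x = y + Pi.single i 1) ↔ (y = x - Pi.single i 1) := by
        constructor <;> (rintro rfl; abel)
      simp only [e1, e2]
    simp only [this]
    rw [Finset.sum_comm]
    simp only [Finset.sum_add_distrib, Finset.sum_ite_eq', Finset.mem_univ, if_true]
    simp; ring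
  exact_mod_cast this

lemma K_torus {d N : ℕ} [NeZero N] (hd : 1 ≤ d) (hN : 3 ≤ N) (z y : Fin d → ZMod N) :
    K (torus d N) z y = 1 / 2 * (if z = y then (1:ℝ) else 0) + 1 / (4 * d) *
      ∑ i, ((if z = y - Pi.single i 1 then (1:ℝ) else 0)
        + (if z = y + Pi.single i 1 then (1:ℝ) else 0)) := by
  have hA : (if ∃ i, y - z = Pi.single i 1 ∨ z - y = Pi.single i 1 then (1:ℝ) else 0)
      = ∑ i, ((if z = y - Pi.single i 1 then (1:ℝ) else 0)
        + (if z = y + Pi.single i 1 then (1:ℝ) else 0)) := by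
    convert! adj_ind (zmod_ne hN).1 (zmod_ne hN).2 z y
  rw [← hA]
  unfold K
  rw [torus_deg hN]
  simp only [torus_adj hN]
  by_cases h : z = y
  · subst h
    simp only [if_true, if_neg (not_nb (zmod_ne hN).1 z), if_neg (show ¬ 2 * d = 0 by omega)]
    simp
  · simp only [if_neg h]
    split_ifs <;> push_cast <;> ring

lemma KZ_eq {d : ℕ} (z y : Fin d → ℤ) :
    KZ d z y = 1 / 2 * (if z = y then (1:ℝ) else 0) + 1 / (4 * d) *
      ∑ i, ((if z = y - Pi.single i 1 then (1:ℝ) else 0)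
        + (if z = y + Pi.single i 1 then (1:ℝ) else 0)) := by
  have hA : (if ∃ i, y - z = Pi.single i 1 ∨ z - y = Pi.single i 1 then (1:ℝ) else 0)
      = ∑ i, ((if z = y - Pi.single i 1 then (1:ℝ) else 0)
        + (if z = y + Pi.single i 1 then (1:ℝ) else 0)) := by
    convert! adj_ind (R := ℤ) (by norm_num) (by norm_num) z y
  rw [← hA]
  unfold KZ
  by_cases h : z = y
  · subst h
    simp only [if_true, if_neg (not_nb (R := ℤ) (by norm_num) z)]
    simp
  · simp only [if_neg h]
    split_ifs <;> ring

lemma K_sum {d N : ℕ} [NeZero N] (hd : 1 ≤ d) (hN : 3 ≤ N) (F : (Fin d → ZMod N) → ℝ) (y : Fin d → ZMod N) :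
    ∑ z, F z * K (torus d N) z y = 1 / 2 * F y + 1 / (4 * d) *
      ∑ i, (F (y - Pi.single i 1) + F (y + Pi.single i 1)) := by
  simp only [K_torus hd hN, mul_add, Finset.sum_add_distrib]
  simp only [Finset.mul_sum]
  congr 1
  · simp [mul_comm]
  · congr 1
    all_goals
      rw [Finset.sum_comm]
      simp [mul_comm]

lemma K_symm {d N : ℕ} [NeZero N] (hd : 1 ≤ d) (hN : 3 ≤ N) (z y : Fin d → ZMod N) :
    K (torus d N) z y = K (torus d N) y z := by
  unfold K
  rw [torus_deg hN, torus_deg hN]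
  simp only [(torus d N).adj_comm z y, eq_comm]

lemma K_row {d N : ℕ} [NeZero N] (hd : 1 ≤ d) (hN : 3 ≤ N) (x : Fin d → ZMod N) :
    ∑ y, K (torus d N) x y = 1 := by
  have := K_sum hd hN (fun _ => 1) x
  simp only [one_mul, K_symm hd hN _ x] at this
  rw [this]
  have : (d:ℝ) ≠ 0 := by positivity
  simp
  field_simp; norm_num

lemma Kpow_step {d N : ℕ} [NeZero N] (hd : 1 ≤ d) (hN : 3 ≤ N) (t : ℕ) (x y : Fin d → ZMod N) :
    Kpow (torus d N) (t+1) x y = 1 / 2 * Kpow (torus d N) t x y + 1 / (4 * d) *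
      ∑ i, (Kpow (torus d N) t x (y - Pi.single i 1) + Kpow (torus d N) t x (y + Pi.single i 1)) := by
  simp only [Kpow]
  rw [K_sum hd hN]

lemma KZpow_step {d : ℕ} (t : ℕ) (x y : Fin d → ℤ) :
    KZpow d (t+1) x y = 1 / 2 * KZpow d t x y + 1 / (4 * d) *
      ∑ i, (KZpow d t x (y - Pi.single i 1) + KZpow d t x (y + Pi.single i 1)) := by
  simp only [KZpow]
  set F := KZpow d t x
  have key : ∀ a : Fin d → ℤ, HasSum (fun z => F z * (if z = a then (1:ℝ) else 0)) (F a) := by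
    intro a
    have := hasSum_single (f := fun z => F z * (if z = a then (1:ℝ) else 0)) a
      (by intro b hb; simp [hb])
    simpa using this
  refine HasSum.tsum_eq ?_
  have h := ((key y).mul_left (1/2)).add ((hasSum_sum (s := Finset.univ) fun i _ =>
    (key (y - Pi.single i 1)).add (key (y + Pi.single i 1))).mul_left (1 / (4 * (d:ℝ))))
  refine h.congr_fun ?_ |> fun h => h
  intro z
  rw [KZ_eq, mul_add]
  congr 1
  · ring
  · rw [mul_left_comm, Finset.mul_sum]
    simp only [mul_add]

lemma Kpow_eq_KZpow {d N : ℕ} [NeZero N] (hd : 1 ≤ d) (hN : 3 ≤ N) (t : ℕ) (y : Fin d → ℤ)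
    (hy : ∀ i, |y i| + t < N) :
    Kpow (torus d N) t 0 (fun i => ((y i : ℤ) : ZMod N)) = KZpow d t 0 y := by
  induction t generalizing y with
  | zero =>
    simp only [Kpow, KZpow]
    have : (0 = fun i => ((y i : ℤ) : ZMod N)) ↔ 0 = y := by
      constructor
      · intro h
        funext i
        have h1 := congrFun h i
        have h2 : (N : ℤ) ∣ y i := (ZMod.intCast_zmod_eq_zero_iff_dvd _ _).1 h1.symm
        have := Int.eq_zero_of_abs_lt_dvd h2 (by simpa using hy i)
        simp [this]
      · rintro rfl; funext i; simp
    simp only [this]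
  | succ t ih =>
    rw [Kpow_step hd hN, KZpow_step, ← ih y (fun i => by have := hy i; push_cast at this; linarith)]
    congr 2
    refine Finset.sum_congr rfl fun i _ => ?_
    have hs : ∀ j, |(Pi.single i (1:ℤ) : Fin d → ℤ) j| ≤ 1 := by
      intro j
      by_cases hij : j = i
      · subst hij; simp
      · rw [Pi.single_eq_of_ne hij]; simp
    have hc : ∀ j, (((Pi.single i (1:ℤ) : Fin d → ℤ) j : ℤ) : ZMod N) = (Pi.single i (1:ZMod N) : Fin d → ZMod N) j := by
      intro j
      by_cases hij : j = i
      · subst hij; simp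
      · rw [Pi.single_eq_of_ne hij, Pi.single_eq_of_ne hij]; simp
    rw [← ih (y - Pi.single i 1), ← ih (y + Pi.single i 1)]
    · congr 2
      · funext j; simp [hc]
      · funext j; simp [hc]
    · intro j
      have := hy j; push_cast at this
      have h3 := abs_add_le (y j) ((Pi.single i (1:ℤ) : Fin d → ℤ) j)
      have h4 := hs j
      rw [Pi.add_apply]; linarith
    · intro j
      have := hy j; push_cast at this
      have h3 := abs_sub (y j) ((Pi.single i (1:ℤ) : Fin d → ℤ) j)
      have h4 := hs j
      rw [Pi.sub_apply]; linarith

lemma Kpow_symm {d N : ℕ} [NeZero N] (hd : 1 ≤ d) (hN : 3 ≤ N) (t : ℕ) (x y : Fin d → ZMod N) :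
    Kpow (torus d N) t x y = Kpow (torus d N) t y x := by
  induction t generalizing x y with
  | zero =>
    simp only [Kpow]
    by_cases h : x = y
    · subst h; simp
    · simp [h, Ne.symm h]
  | succ t ih =>
    have h1 : ∀ a b, Kpow (torus d N) 1 a b = K (torus d N) a b := by
      intro a b; simp [Kpow]
    rw [add_comm, Kpow_add, add_comm]
    simp only [h1]
    rw [Kpow]
    refine Finset.sum_congr rfl fun z _ => ?_
    rw [ih z y, K_symm hd hN, mul_comm]

end tor

section fou
open Complex in
/-- characters of the torus -/
def chi {d N : ℕ} [NeZero N] (k x : Fin d → ZMod N) : ℂ :=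
  ∏ i, ZMod.stdAddChar (k i * x i)

/-- eigenvalues -/
def lam {d N : ℕ} [NeZero N] (k : Fin d → ZMod N) : ℝ :=
  1 / 2 + 1 / (2 * d) * ∑ i, (ZMod.stdAddChar (k i) : ℂ).re

variable {d N : ℕ} [NeZero N]

lemma chi_add (k x y : Fin d → ZMod N) : chi k (x + y) = chi k x * chi k y := by
  simp only [chi, Pi.add_apply, mul_add, AddChar.map_add_eq_mul, Finset.prod_mul_distrib]

lemma chi_single (k : Fin d → ZMod N) (i : Fin d) :
    chi k (Pi.single i 1) = ZMod.stdAddChar (k i) := by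
  unfold chi
  rw [Finset.prod_eq_single i]
  · simp
  · intro j _ hj; rw [Pi.single_eq_of_ne hj]; simp
  · simp

lemma chi_neg_single (k : Fin d → ZMod N) (i : Fin d) :
    chi k (-Pi.single i 1) = ZMod.stdAddChar (-k i) := by
  unfold chi
  rw [Finset.prod_eq_single i]
  · simp
  · intro j _ hj; rw [Pi.neg_apply, Pi.single_eq_of_ne hj]; simp
  · simp

lemma chi_norm (k x : Fin d → ZMod N) : ‖chi k x‖ = 1 := by
  unfold chi
  rw [norm_prod]
  refine Finset.prod_eq_one fun i _ => ?_
  exact Circle.norm_coe _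

lemma chi_zero (k : Fin d → ZMod N) : chi k 0 = 1 := by simp [chi]
lemma chi_zero' (k : Fin d → ZMod N) : chi 0 k = 1 := by simp [chi]

lemma std_add_neg (j : ZMod N) :
    (ZMod.stdAddChar j : ℂ) + ZMod.stdAddChar (-j) = 2 * ((ZMod.stdAddChar j : ℂ).re : ℂ) := by
  rw [AddChar.map_neg_eq_conj, Complex.add_conj]; push_cast; ring

lemma chi_step (hd : 1 ≤ d) (k x : Fin d → ZMod N) :
    (1 / 2 : ℂ) * chi k x + 1 / (4 * d) * ∑ i, (chi k (x + Pi.single i 1) + chi k (x - Pi.single i 1))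
      = lam k * chi k x := by
  have hd0 : (d:ℂ) ≠ 0 := by
    have : d ≠ 0 := by omega
    exact_mod_cast this
  simp only [sub_eq_add_neg, chi_add, chi_single, chi_neg_single, ← mul_add, std_add_neg]
  rw [← Finset.mul_sum, ← Finset.mul_sum]
  unfold lam
  push_cast
  field_simp
  ring

lemma chi_orth (x : Fin d → ZMod N) :
    ∑ k, chi k x = if x = 0 then (N:ℂ) ^ d else 0 := by
  have h : ∑ k, chi k x = ∏ i, ∑ j : ZMod N, (ZMod.stdAddChar (j * x i) : ℂ) := by
    unfold chi
    convert! (Fintype.prod_sum (fun (i : Fin d) (j : ZMod N) => (ZMod.stdAddChar (j * x i) : ℂ))).symm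
  rw [h]
  simp only [AddChar.sum_mulShift _ (ZMod.isPrimitive_stdAddChar N), ZMod.card]
  split_ifs with hx
  · subst hx; simp
  · obtain ⟨i, hi⟩ := Function.ne_iff.1 hx
    refine Finset.prod_eq_zero (Finset.mem_univ i) ?_
    rw [if_neg (by simpa using hi)]; simp

lemma fourier (hd : 1 ≤ d) (hN : 3 ≤ N) (t : ℕ) (x y : Fin d → ZMod N) :
    ((Kpow (torus d N) t x y : ℝ) : ℂ)
      = ((N:ℂ) ^ d)⁻¹ * ∑ k, (lam k : ℂ) ^ t * chi k (x - y) := by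
  have hN0 : (N:ℂ) ≠ 0 := by exact_mod_cast NeZero.ne N
  induction t generalizing y with
  | zero =>
    simp only [pow_zero, one_mul, chi_orth, Kpow]
    by_cases h : x = y
    · subst h; simp [hN0]
    · simp [h, sub_eq_zero]
  | succ t ih =>
    rw [Kpow_step hd hN]
    push_cast
    simp only [ih]
    have : ∀ k : Fin d → ZMod N, (lam k : ℂ) ^ (t+1) * chi k (x - y) = 
        (lam k : ℂ) ^ t * ((1 / 2 : ℂ) * chi k (x - y) + 1 / (4 * d) * ∑ i, (chi k (x - y + Pi.single i 1) + chi k (x - y - Pi.single i 1))) := by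
      intro k; rw [chi_step hd]; ring
    simp only [this, mul_add, Finset.sum_add_distrib, Finset.mul_sum]
    simp only [sub_add, sub_add_eq_sub_sub, sub_sub_eq_add_sub]
    congr 1
    · refine Finset.sum_congr rfl fun k _ => ?_
      ring
    · congr 1
      · rw [Finset.sum_comm]
        refine Finset.sum_congr rfl fun k _ => Finset.sum_congr rfl fun i _ => ?_
        ring
      · rw [Finset.sum_comm]
        refine Finset.sum_congr rfl fun k _ => Finset.sum_congr rfl fun i _ => ?_
        ring

lemma Kpow_diag (hd : 1 ≤ d) (hN : 3 ≤ N) (t : ℕ) (x : Fin d → ZMod N) :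
    Kpow (torus d N) t x x = Kpow (torus d N) t 0 0 := by
  have h1 := fourier hd hN t x x
  have h2 := fourier hd hN t (0 : Fin d → ZMod N) 0
  rw [sub_self] at h1 h2
  exact_mod_cast h1.trans h2.symm

lemma std_re (j : ZMod N) : (ZMod.stdAddChar j : ℂ).re = Real.cos (2 * Real.pi * j.val / N) := by
  rw [ZMod.stdAddChar_apply, ZMod.toCircle_apply]
  have : (2 * Real.pi * Complex.I * j.val / N : ℂ) = ((2 * Real.pi * j.val / N : ℝ) : ℂ) * Complex.I := by
    push_cast; ring
  rw [this, Complex.exp_ofReal_mul_I_re]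

lemma lam_sub (hd : 1 ≤ d) (k : Fin d → ZMod N) :
    lam k = 1 + ∑ i, (Real.cos (2 * Real.pi * (k i).val / N) - 1) / (2 * d) := by
  have hd0 : (d:ℝ) ≠ 0 := by positivity
  unfold lam
  simp only [std_re]
  rw [← Finset.sum_div, Finset.sum_sub_distrib]
  simp
  field_simp
  ring

lemma lam_nonneg (hd : 1 ≤ d) (k : Fin d → ZMod N) : 0 ≤ lam k := by
  have hd0 : (0:ℝ) < d := by positivity
  rw [lam_sub hd]
  have : ∑ i : Fin d, (-1/(d:ℝ)) ≤ ∑ i, (Real.cos (2 * Real.pi * (k i).val / N) - 1) / (2 * d) := by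
    refine Finset.sum_le_sum fun i _ => ?_
    rw [div_le_div_iff₀ hd0 (by positivity)]
    nlinarith [Real.neg_one_le_cos (2 * Real.pi * (k i).val / N)]
  rw [Finset.sum_const, Finset.card_univ, Fintype.card_fin, nsmul_eq_mul,
    mul_div_cancel₀ _ hd0.ne'] at this
  linarith

lemma lam_zero (hd : 1 ≤ d) : lam (0 : Fin d → ZMod N) = 1 := by
  rw [lam_sub hd]; simp

/-- one-dimensional weight -/
def wt (d N t : ℕ) (v : ℕ) : ℝ := Real.exp (t * ((Real.cos (2 * Real.pi * v / N) - 1) / (2 * d)))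

lemma lam_pow_le (hd : 1 ≤ d) (t : ℕ) (k : Fin d → ZMod N) :
    lam k ^ t ≤ ∏ i, wt d N t (k i).val := by
  unfold wt
  rw [← Real.exp_sum, ← Finset.mul_sum, mul_comm (t:ℝ), Real.exp_mul, Real.rpow_natCast]
  refine pow_le_pow_left₀ (lam_nonneg hd k) ?_ t
  rw [lam_sub hd, add_comm]
  exact Real.add_one_le_exp _

lemma sum_lam_le (hd : 1 ≤ d) (t : ℕ) :
    ∑ k : Fin d → ZMod N, lam k ^ t ≤ (∑ v ∈ Finset.range N, wt d N t v) ^ d := by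
  have h1 : ∑ v ∈ Finset.range N, wt d N t v = ∑ j : ZMod N, wt d N t j.val := by
    obtain ⟨n, rfl⟩ : ∃ n, N = n + 1 := ⟨N - 1, by have := NeZero.ne N; omega⟩
    exact (Fin.sum_univ_eq_sum_range (wt d (n+1) t) (n+1)).symm
  have h2 : ∑ k : Fin d → ZMod N, ∏ i, wt d N t (k i).val = (∑ j : ZMod N, wt d N t j.val) ^ d := by
    have := (Fintype.prod_sum (fun (i : Fin d) (j : ZMod N) => wt d N t j.val)).symm
    rw [Finset.prod_const, Finset.card_univ, Fintype.card_fin] at this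
    convert! this
  rw [h1, ← h2]
  exact Finset.sum_le_sum fun k _ => lam_pow_le hd t k

lemma heat (hd : 1 ≤ d) (hN : 3 ≤ N) (t : ℕ) (x y : Fin d → ZMod N) :
    |Kpow (torus d N) t x y - ((N:ℝ) ^ d)⁻¹| ≤
      ((N:ℝ) ^ d)⁻¹ * ((∑ v ∈ Finset.range N, wt d N t v) ^ d - 1) := by
  have h1 : ((Kpow (torus d N) t x y - ((N:ℝ) ^ d)⁻¹ : ℝ) : ℂ)
      = ((N:ℂ) ^ d)⁻¹ * ∑ k ∈ Finset.univ.erase (0 : Fin d → ZMod N), (lam k : ℂ) ^ t * chi k (x - y) := by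
    push_cast
    rw [fourier hd hN, ← Finset.add_sum_erase _ _ (Finset.mem_univ (0 : Fin d → ZMod N)),
      lam_zero hd, chi_zero']
    push_cast
    ring
  rw [← Real.norm_eq_abs, ← Complex.norm_real, h1, norm_mul]
  have h2 : ‖((N:ℂ) ^ d)⁻¹‖ = ((N:ℝ) ^ d)⁻¹ := by simp
  rw [h2]
  gcongr
  refine (norm_sum_le _ _).trans ?_
  have h3 : ∑ k ∈ Finset.univ.erase (0 : Fin d → ZMod N), ‖(lam k : ℂ) ^ t * chi k (x - y)‖
      = ∑ k ∈ Finset.univ.erase (0 : Fin d → ZMod N), lam k ^ t := by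
    refine Finset.sum_congr rfl fun k _ => ?_
    rw [norm_mul, chi_norm, mul_one, norm_pow, Complex.norm_real, Real.norm_of_nonneg (lam_nonneg hd k)]
  rw [h3]
  have h4 := sum_lam_le (N := N) hd t
  rw [← Finset.add_sum_erase _ _ (Finset.mem_univ (0 : Fin d → ZMod N)), lam_zero hd, one_pow] at h4
  linarith

lemma wt_le (hd : 1 ≤ d) (t v : ℕ) (hv : v ≤ N) :
    wt d N t v ≤ Real.exp (-(4 * t / (d * N ^ 2) * (v:ℝ) ^ 2))
      + Real.exp (-(4 * t / (d * N ^ 2) * ((N - v : ℕ):ℝ) ^ 2)) := by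
  have hd0 : (0:ℝ) < d := by positivity
  have hN0 : (0:ℝ) < N := by exact_mod_cast Nat.pos_of_ne_zero (NeZero.ne N)
  have hpi := Real.pi_pos
  have key : ∀ u : ℝ, 0 ≤ u → 2 * u ≤ N → Real.exp (t * ((Real.cos (2 * Real.pi * u / N) - 1) / (2 * d)))
      ≤ Real.exp (-(4 * t / (d * N ^ 2) * u ^ 2)) := by
    intro u hu huN
    rw [Real.exp_le_exp]
    have h1 : |2 * Real.pi * u / N| ≤ Real.pi := by
      rw [abs_of_nonneg (by positivity), div_le_iff₀ hN0]
      nlinarith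
    have h2 := Real.cos_le_one_sub_mul_cos_sq h1
    have h3 : 2 / Real.pi ^ 2 * (2 * Real.pi * u / N) ^ 2 = 8 * u ^ 2 / N ^ 2 := by
      field_simp; ring
    rw [h3] at h2
    calc (t:ℝ) * ((Real.cos (2 * Real.pi * u / N) - 1) / (2 * d))
        ≤ t * ((-(8 * u ^ 2 / N ^ 2)) / (2 * d)) := by gcongr; linarith
      _ = _ := by field_simp; ring
  rcases le_total (2 * (v:ℝ)) N with h | h
  · have := key v (by positivity) h
    unfold wt
    linarith [Real.exp_pos (-(4 * t / (d * N ^ 2) * ((N - v : ℕ):ℝ) ^ 2))]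
  · have hc : ((N - v : ℕ):ℝ) = N - v := by push_cast [hv]; ring
    have hv' : (v:ℝ) ≤ N := by exact_mod_cast hv
    have := key (N - v) (by linarith) (by linarith)
    have h4 : Real.cos (2 * Real.pi * (N - v) / N) = Real.cos (2 * Real.pi * v / N) := by
      have : 2 * Real.pi * (N - v) / N = 2 * Real.pi - 2 * Real.pi * v / N := by field_simp
      rw [this, Real.cos_two_pi_sub]
    rw [h4] at this
    rw [hc]
    unfold wt
    linarith [Real.exp_pos (-(4 * t / (d * N ^ 2) * (v:ℝ) ^ 2))]

lemma sum_wt_le (hd : 1 ≤ d) (t : ℕ) :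
    ∑ v ∈ Finset.range N, wt d N t v ≤
      1 + 2 * ∑ v ∈ Finset.Ioo 0 N, Real.exp (-(4 * t / (d * N ^ 2) * (v:ℝ) ^ 2)) := by
  have hN0 : 0 < N := Nat.pos_of_ne_zero (NeZero.ne N)
  have h1 : Finset.range N = insert 0 (Finset.Ioo 0 N) := by
    ext v; simp; omega
  rw [h1, Finset.sum_insert (by simp)]
  have h2 : wt d N t 0 = 1 := by simp [wt]
  rw [h2]
  gcongr
  calc _ ≤ ∑ v ∈ Finset.Ioo 0 N, (Real.exp (-(4 * t / (d * N ^ 2) * (v:ℝ) ^ 2))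
      + Real.exp (-(4 * t / (d * N ^ 2) * ((N - v : ℕ):ℝ) ^ 2))) := 
        Finset.sum_le_sum fun v hv => wt_le hd t v (by simp at hv; omega)
    _ = _ := by
      rw [Finset.sum_add_distrib, two_mul]
      congr 1
      refine Finset.sum_nbij' (fun v => N - v) (fun v => N - v) ?_ ?_ ?_ ?_ ?_
      all_goals intro v hv; simp at hv ⊢
      all_goals omega

/-- Gaussian sum bounds -/
lemma gauss1 (a : ℝ) (ha : 0 < a) (N : ℕ) :
    ∑ v ∈ Finset.Ioo 0 N, Real.exp (-(a * (v:ℝ) ^ 2)) ≤ 2 / a := by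
  have h := sum_Ioo_inv_sq_le (α := ℝ) 0 N
  calc _ ≤ ∑ v ∈ Finset.Ioo 0 N, a⁻¹ * ((v:ℝ) ^ 2)⁻¹ := by
        refine Finset.sum_le_sum fun v hv => ?_
        have : 0 < v := (Finset.mem_Ioo.1 hv).1
        have hv0 : (0:ℝ) < v := by exact_mod_cast this
        rw [Real.exp_neg, ← mul_inv]
        gcongr
        linarith [Real.add_one_le_exp (a * (v:ℝ) ^ 2)]
    _ = a⁻¹ * ∑ v ∈ Finset.Ioo 0 N, ((v:ℝ) ^ 2)⁻¹ := by rw [Finset.mul_sum]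
    _ ≤ a⁻¹ * 2 := by gcongr; simpa using h
    _ = 2 / a := by ring

lemma gauss2 (b : ℝ) (hb : 0 < b) (N : ℕ) :
    ∑ v ∈ Finset.Ioo 0 N, Real.exp (-(b ^ 2 * (v:ℝ) ^ 2)) ≤ 1 + 3 / b := by
  obtain ⟨Q, hQ⟩ : ∃ Q : ℕ, Q = ⌈1 / b⌉₊ := ⟨_, rfl⟩
  have hQ1 : 1 / b ≤ Q := hQ ▸ Nat.le_ceil _
  have hQ2 : (Q:ℝ) < 1 / b + 1 := hQ ▸ Nat.ceil_lt_add_one (by positivity)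
  have hsub : Finset.Ioo 0 N ⊆ Finset.Ioc 0 Q ∪ Finset.Ioo Q N := by
    intro v; simp; omega
  have hdis : Disjoint (Finset.Ioc 0 Q) (Finset.Ioo Q N) := by
    rw [Finset.disjoint_left]; intro v; simp; omega
  have h := sum_Ioo_inv_sq_le (α := ℝ) Q N
  calc _ ≤ ∑ v ∈ Finset.Ioc 0 Q ∪ Finset.Ioo Q N, Real.exp (-(b ^ 2 * (v:ℝ) ^ 2)) :=
        Finset.sum_le_sum_of_subset_of_nonneg hsub fun _ _ _ => (Real.exp_pos _).le
    _ = ∑ v ∈ Finset.Ioc 0 Q, Real.exp (-(b ^ 2 * (v:ℝ) ^ 2))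
        + ∑ v ∈ Finset.Ioo Q N, Real.exp (-(b ^ 2 * (v:ℝ) ^ 2)) := Finset.sum_union hdis
    _ ≤ ∑ v ∈ Finset.Ioc 0 Q, 1 + ∑ v ∈ Finset.Ioo Q N, (b^2)⁻¹ * ((v:ℝ) ^ 2)⁻¹ := by
        gcongr with v hv v hv
        · rw [Real.exp_le_one_iff]; simp only [Left.neg_nonpos_iff]; positivity
        · have : 0 < v := by have := (Finset.mem_Ioo.1 hv).1; omega
          have hv0 : (0:ℝ) < v := by exact_mod_cast this
          rw [Real.exp_neg, ← mul_inv]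
          gcongr
          linarith [Real.add_one_le_exp (b ^ 2 * (v:ℝ) ^ 2)]
    _ = Q + (b^2)⁻¹ * ∑ v ∈ Finset.Ioo Q N, ((v:ℝ) ^ 2)⁻¹ := by
        rw [Finset.mul_sum]; simp
    _ ≤ (1 / b + 1) + (b^2)⁻¹ * (2 / (1 / b)) := by
        gcongr
        refine h.trans ?_
        gcongr
        linarith
    _ = 1 + 3 / b := by field_simp; ring

end fou

section fin

/-- `(t+1)^{-1/2}` -/
def rr (t : ℕ) : ℝ := (Real.sqrt ((t:ℝ) + 1))⁻¹

lemma rr_pos (t : ℕ) : 0 < rr t := by unfold rr; positivity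

lemma rr_le_one (t : ℕ) : rr t ≤ 1 := by
  unfold rr
  refine inv_le_one_of_one_le₀ ?_
  rw [Real.one_le_sqrt]
  have : (0:ℝ) ≤ t := by positivity
  linarith

lemma rr_sq (t : ℕ) : rr t ^ 2 = ((t:ℝ) + 1)⁻¹ := by
  unfold rr
  rw [inv_pow, Real.sq_sqrt (by positivity)]

lemma rr_summable : Summable (fun t => rr t ^ 3) := by
  have h := (summable_nat_add_iff 1).2 (Real.summable_nat_rpow (p := -(3/2)) |>.2 (by norm_num))
  refine h.congr fun t => ?_
  unfold rr
  rw [Real.sqrt_eq_rpow, ← Real.rpow_neg (by positivity), ← Real.rpow_natCast, ← Real.rpow_mul (by positivity)]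
  push_cast
  norm_num

lemma heat_diag {d : ℕ} (hd : 1 ≤ d) : ∃ C : ℝ, 0 < C ∧ ∀ (N : ℕ) [NeZero N], 3 ≤ N → ∀ t,
    Kpow (torus d N) t 0 0 ≤ C * (rr t ^ d + ((N:ℝ) ^ d)⁻¹) := by
  have hd1 : (1:ℝ) ≤ d := by exact_mod_cast hd
  refine ⟨(6 * d) ^ d * 2 ^ (d - 1), by positivity, ?_⟩
  intro N _ hN t
  have hN0 : (0:ℝ) < N := by exact_mod_cast (by omega : 0 < N)
  have hC : 1 ≤ (6 * (d:ℝ)) ^ d * 2 ^ (d - 1) := by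
    refine one_le_mul_of_one_le_of_one_le (one_le_pow₀ (by linarith)) (one_le_pow₀ (by norm_num))
  rcases Nat.eq_zero_or_pos t with rfl | ht
  · have h0 : Kpow (torus d N) 0 0 0 = 1 := by simp [Kpow]
    have h1 : rr 0 = 1 := by simp [rr]
    rw [h0, h1, one_pow]
    have : 0 ≤ ((N:ℝ) ^ d)⁻¹ := by positivity
    nlinarith
  · have ht0 : (1:ℝ) ≤ t := by exact_mod_cast ht
    have hst : 0 < Real.sqrt t := Real.sqrt_pos.2 (by linarith)
    have hsd : 0 < Real.sqrt d := Real.sqrt_pos.2 (by linarith)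
    have h1 := (abs_le.1 (heat hd hN t 0 0)).2
    have h2 := sum_wt_le (N := N) hd t
    obtain ⟨b, hb⟩ : ∃ b : ℝ, b = 2 * Real.sqrt t / (Real.sqrt d * N) := ⟨_, rfl⟩
    have hb0 : 0 < b := by rw [hb]; positivity
    have hb2 : 4 * t / (d * N ^ 2) = b ^ 2 := by
      rw [hb, div_pow, mul_pow, mul_pow, Real.sq_sqrt (by linarith), Real.sq_sqrt (by linarith)]
      norm_num
    rw [hb2] at h2
    have h3 := gauss2 b hb0 N
    set W := ∑ v ∈ Finset.range N, wt d N t v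
    have hW0 : 0 ≤ W := Finset.sum_nonneg fun v _ => (Real.exp_pos _).le
    have hbi : 1 / b = Real.sqrt d * N / (2 * Real.sqrt t) := by rw [hb, one_div_div]
    have hrt : 1 / Real.sqrt t ≤ 2 * rr t := by
      unfold rr
      rw [div_le_iff₀ hst, mul_assoc, ← div_eq_inv_mul, ← mul_div_assoc, le_div_iff₀ (by positivity), one_mul]
      refine Real.sqrt_le_iff.2 ⟨by positivity, ?_⟩
      rw [mul_pow, Real.sq_sqrt (by linarith)]
      linarith
    have hsdd : Real.sqrt d ≤ d := Real.sqrt_le_iff.2 ⟨by positivity, by nlinarith⟩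
    have hW : W ≤ N * (6 * d * (rr t + (N:ℝ)⁻¹)) := by
      have e1 : W ≤ 3 + 6 * (1 / b) := by
        have : 3 / b = 3 * (1 / b) := by ring
        linarith
      have e2 : 6 * (1 / b) ≤ N * (6 * d * rr t) := by
        rw [hbi]
        calc 6 * (Real.sqrt d * N / (2 * Real.sqrt t)) = 3 * N * Real.sqrt d * (1 / Real.sqrt t) := by
              field_simp; ring
          _ ≤ 3 * N * d * (2 * rr t) := by gcongr
          _ = _ := by ring
      have e3 : (N:ℝ) * (6 * d * (N:ℝ)⁻¹) = 6 * d := by field_simp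
      rw [mul_add, mul_add, e3]
      linarith
    have hr := rr_pos t
    calc Kpow (torus d N) t 0 0 ≤ ((N:ℝ) ^ d)⁻¹ * W ^ d := by linarith [mul_sub_one ((N:ℝ) ^ d)⁻¹ (W ^ d)]
      _ ≤ ((N:ℝ) ^ d)⁻¹ * (N * (6 * d * (rr t + (N:ℝ)⁻¹))) ^ d := by gcongr
      _ = (6 * d) ^ d * (rr t + (N:ℝ)⁻¹) ^ d := by
        rw [mul_pow, mul_pow _ _ d, ← mul_assoc, inv_mul_cancel₀ (by positivity), one_mul]
      _ ≤ (6 * d) ^ d * (2 ^ (d - 1) * (rr t ^ d + (N:ℝ)⁻¹ ^ d)) := by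
        gcongr
        exact add_pow_le hr.le (by positivity) d
      _ = _ := by rw [inv_pow]; ring

lemma unif_eq {d N : ℕ} [NeZero N] : unif (Fin d → ZMod N) = ((N:ℝ) ^ d)⁻¹ := by
  simp [unif, ZMod.card]

lemma tmix_mem {d : ℕ} (hd : 1 ≤ d) (N : ℕ) [NeZero N] (hN : 3 ≤ N) :
    ∀ x y : Fin d → ZMod N,
      |Kpow (torus d N) (5 * d ^ 2 * N ^ 2) x y / unif (Fin d → ZMod N) - 1| ≤ 1 / 4 := by
  intro x y
  have hd1 : (1:ℝ) ≤ d := by exact_mod_cast hd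
  have hN0 : (0:ℝ) < N := by exact_mod_cast (by omega : 0 < N)
  have h1 := heat hd hN (5 * d ^ 2 * N ^ 2) x y
  have h2 := sum_wt_le (N := N) hd (5 * d ^ 2 * N ^ 2)
  have ha : 4 * ((5 * d ^ 2 * N ^ 2 : ℕ):ℝ) / (d * N ^ 2) = 20 * d := by
    push_cast; field_simp; ring
  rw [ha] at h2
  have h3 := gauss1 (20 * d) (by positivity) N
  set W := ∑ v ∈ Finset.range N, wt d N (5 * d ^ 2 * N ^ 2) v
  have hW0 : 0 ≤ W := Finset.sum_nonneg fun v _ => (Real.exp_pos _).le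
  have hW : W ≤ 1 / (5 * d) + 1 := by
    have : 2 / (20 * (d:ℝ)) * 2 = 1 / (5 * d) := by field_simp; norm_num
    linarith
  have hWd : W ^ d ≤ 5 / 4 := by
    calc W ^ d ≤ (Real.exp (1 / (5 * d))) ^ d := by
          gcongr; exact hW.trans (Real.add_one_le_exp _)
      _ = Real.exp (1 / 5) := by
          rw [← Real.exp_nat_mul]; congr 1; field_simp
      _ ≤ 5 / 4 := by
          have h4 := Real.add_one_le_exp (-(1/5:ℝ))
          rw [Real.exp_neg] at h4
          have h5 := Real.exp_pos (1/5:ℝ)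
          rw [show (5/4:ℝ) = (4/5)⁻¹ by norm_num]
          rw [← inv_inv (Real.exp (1/5))]
          gcongr
          linarith
  rw [unif_eq]
  have hu : 0 < ((N:ℝ) ^ d)⁻¹ := by positivity
  set u := ((N:ℝ) ^ d)⁻¹
  have : Kpow (torus d N) (5 * d ^ 2 * N ^ 2) x y / u - 1 = (Kpow (torus d N) (5 * d ^ 2 * N ^ 2) x y - u) / u := by
    field_simp
  rw [this, abs_div, abs_of_pos hu, div_le_iff₀ hu]
  refine h1.trans ?_
  nlinarith

lemma tmix_le {d : ℕ} (hd : 1 ≤ d) (N : ℕ) [NeZero N] (hN : 3 ≤ N) :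
    Tmix (torus d N) ≤ 5 * d ^ 2 * N ^ 2 := Nat.sInf_le (tmix_mem hd N hN)

lemma after_mix {d : ℕ} (hd : 1 ≤ d) (N : ℕ) [NeZero N] (hN : 3 ≤ N) (t : ℕ)
    (ht : Tmix (torus d N) ≤ t) (x y : Fin d → ZMod N) :
    Kpow (torus d N) t x y ≤ 5 / 4 * ((N:ℝ) ^ d)⁻¹ := by
  have hN0 : (0:ℝ) < N := by exact_mod_cast (by omega : 0 < N)
  have hu : 0 < ((N:ℝ) ^ d)⁻¹ := by positivity
  have h0 : Tmix (torus d N) ∈ {t : ℕ | ∀ x y : Fin d → ZMod N,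
      |Kpow (torus d N) t x y / unif (Fin d → ZMod N) - 1| ≤ 1 / 4} :=
    Nat.sInf_mem ⟨_, tmix_mem hd N hN⟩
  obtain ⟨s, rfl⟩ := Nat.exists_eq_add_of_le' ht
  refine Kpow_sup_mono _ (K_row hd hN) _ s _ (fun x y => ?_) x y
  have := (abs_le.1 (h0 x y)).2
  rw [unif_eq] at this
  have h2 : Kpow (torus d N) (Tmix (torus d N)) x y / ((N:ℝ) ^ d)⁻¹ ≤ 5 / 4 := by linarith
  rwa [div_le_iff₀ hu] at h2

lemma KZ_torus {d N : ℕ} [NeZero N] (hd : 1 ≤ d) (hN : 3 ≤ N) (t : ℕ) (ht : t < N) :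
    Kpow (torus d N) t 0 0 = KZpow d t 0 0 := by
  rw [← Kpow_eq_KZpow hd hN t 0 (by intro i; simpa using ht)]
  congr 1
  funext i; simp

lemma KZ_nonneg {d : ℕ} (hd : 1 ≤ d) (t : ℕ) : 0 ≤ KZpow d t 0 0 := by
  rw [← KZ_torus (N := t + 3) hd (by omega) t (by omega)]
  exact Kpow_nonneg _ _ _ _

lemma KZ_summable {d : ℕ} (hd : 3 ≤ d) : Summable (fun t => KZpow d t 0 0) := by
  obtain ⟨C, hC, h⟩ := heat_diag (d := d) (by omega)
  refine Summable.of_nonneg_of_le (KZ_nonneg (by omega)) (fun t => ?_) (rr_summable.mul_left (2 * C))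
  rw [← KZ_torus (N := t + 3) (by omega) (by omega) t (by omega)]
  refine (h (t+3) (by omega) t).trans ?_
  have h1 : rr t ^ d ≤ rr t ^ 3 := pow_le_pow_of_le_one (rr_pos t).le (rr_le_one t) hd
  have h2 : (((t + 3 : ℕ):ℝ) ^ d)⁻¹ ≤ rr t ^ d := by
    unfold rr
    rw [inv_pow]
    gcongr
    refine Real.sqrt_le_iff.2 ⟨by positivity, ?_⟩
    push_cast
    have : (0:ℝ) ≤ t := by positivity
    nlinarith
  nlinarith

lemma green_ge_one {d : ℕ} (hd : 3 ≤ d) : 1 ≤ greenZ d 0 := by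
  have := (KZ_summable hd).le_tsum 0 (fun t _ => KZ_nonneg (by omega) t)
  refine le_trans ?_ this
  simp [KZpow]

lemma green_close {d : ℕ} (hd : 3 ≤ d) (B : ℕ) (ε : ℝ) (hε : 0 < ε) :
    ∃ S N0 : ℕ, ∀ (N : ℕ) [NeZero N], 3 ≤ N → N0 ≤ N → ∀ T, T ≤ B * N ^ 2 →
      greenZ d 0 - ε ≤ gs (torus d N) S 0 0 ∧ gs (torus d N) T 0 0 ≤ greenZ d 0 + 3 * ε := by
  obtain ⟨C, hC, hheat⟩ := heat_diag (d := d) (by omega)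
  have hs := KZ_summable hd
  have hr := rr_summable.mul_left C
  have ev1 := hs.hasSum.tendsto_sum_nat.eventually (lt_mem_nhds (show greenZ d 0 - ε < ∑' t, KZpow d t 0 0 by
    unfold greenZ; linarith))
  have ev2 := hr.hasSum.tendsto_sum_nat.eventually
    (lt_mem_nhds (show ∑' t, C * rr t ^ 3 - ε < ∑' t, C * rr t ^ 3 by linarith))
  obtain ⟨S, hS⟩ := eventually_atTop.1 (ev1.and ev2)
  obtain ⟨hS1, hS2⟩ := hS (S+1) (by omega)
  obtain ⟨Q, hQ⟩ := exists_nat_ge (C * (B + 1) / ε)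
  refine ⟨S, max (S + 2) Q, ?_⟩
  intro N _ hN hNS T hT
  have hN0 : (0:ℝ) < N := by exact_mod_cast (by omega : 0 < N)
  have hgs : gs (torus d N) S 0 0 = ∑ t ∈ Finset.range (S+1), KZpow d t 0 0 := by
    unfold gs
    refine Finset.sum_congr rfl fun t ht => KZ_torus (by omega) hN t ?_
    have := Finset.mem_range.1 ht
    have := le_trans (le_max_left _ _) hNS
    omega
  refine ⟨by rw [hgs]; exact hS1.le, ?_⟩
  have hgsG : gs (torus d N) S 0 0 ≤ greenZ d 0 := by
    rw [hgs]; exact hs.sum_le_tsum _ (fun t _ => KZ_nonneg (by omega) t)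
  have h2 : gs (torus d N) T 0 0 ≤ gs (torus d N) S 0 0 + ∑ t ∈ Finset.range T, Kpow (torus d N) (S+1+t) 0 0 := by
    have : gs (torus d N) (S+T) 0 0 = gs (torus d N) S 0 0 + ∑ t ∈ Finset.range T, Kpow (torus d N) (S+1+t) 0 0 := by
      unfold gs
      rw [show S + T + 1 = S + 1 + T by ring, Finset.sum_range_add]
    rw [← this]
    exact gs_mono _ (by omega) _ _
  have h3 : ∑ t ∈ Finset.range T, Kpow (torus d N) (S+1+t) 0 0
      ≤ ∑ t ∈ Finset.range T, (C * rr (S+1+t) ^ 3 + C * ((N:ℝ) ^ d)⁻¹) := by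
    refine Finset.sum_le_sum fun t _ => (hheat N hN _).trans ?_
    rw [mul_add]
    gcongr C * ?_ + _
    exact pow_le_pow_of_le_one (rr_pos _).le (rr_le_one _) hd
  rw [Finset.sum_add_distrib, Finset.sum_const, Finset.card_range, nsmul_eq_mul] at h3
  have h4 : ∑ t ∈ Finset.range T, C * rr (S+1+t) ^ 3 ≤ ε := by
    have e1 := hr.sum_le_tsum (Finset.range (S+1+T)) (fun t _ => by have := rr_pos t; positivity)
    rw [Finset.sum_range_add] at e1
    linarith
  have h5 : (T:ℝ) * (C * ((N:ℝ) ^ d)⁻¹) ≤ ε := by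
    have hT' : (T:ℝ) ≤ B * N ^ 2 := by exact_mod_cast hT
    have hQN : (Q:ℝ) ≤ N := by exact_mod_cast le_trans (le_max_right _ _) hNS
    have hN1 : (1:ℝ) ≤ N := by exact_mod_cast (by omega : 1 ≤ N)
    have e1 : C * (B + 1) ≤ N * ε := by
      rw [div_le_iff₀ hε] at hQ
      nlinarith
    calc (T:ℝ) * (C * ((N:ℝ) ^ d)⁻¹) ≤ ((B + 1) * N ^ 2) * (C * ((N:ℝ) ^ 3)⁻¹) := by
          gcongr
          nlinarith [sq_nonneg (N:ℝ)]
      _ = (C * (B + 1)) / N := by field_simp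
      _ ≤ ε := by rw [div_le_iff₀ hN0]; linarith
  linarith

end fin

section last

lemma double_sum (F : ℕ → ℝ) (hF : ∀ k, 0 ≤ F k) (A : ℕ) :
    ∑ s ∈ Finset.range A, ∑ t ∈ Finset.range A, F (s + t)
      ≤ ∑ k ∈ Finset.range (2 * A), ((k:ℝ) + 1) * F k := by
  have h1 : ∀ s ∈ Finset.range A, ∑ t ∈ Finset.range A, F (s + t)
      ≤ ∑ k ∈ Finset.range (2 * A), if s ≤ k then F k else 0 := by
    intro s hs
    have hs' := Finset.mem_range.1 hs
    rw [← Finset.sum_filter]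
    have : ∑ t ∈ Finset.range A, F (s + t) = ∑ k ∈ Finset.Ico s (s + A), F k := by
      rw [Finset.sum_Ico_eq_sum_range]; simp
    rw [this]
    refine Finset.sum_le_sum_of_subset_of_nonneg ?_ fun k _ _ => hF k
    intro k; simp; omega
  refine (Finset.sum_le_sum h1).trans ?_
  rw [Finset.sum_comm]
  refine Finset.sum_le_sum fun k _ => ?_
  rw [← Finset.sum_filter, Finset.sum_const, nsmul_eq_mul]
  refine mul_le_mul_of_nonneg_right ?_ (hF k)
  have : ((Finset.range A).filter (fun s => s ≤ k)).card ≤ (Finset.range (k+1)).card := by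
    refine Finset.card_le_card ?_
    intro s hs
    have := (Finset.mem_filter.1 hs).2
    exact Finset.mem_range.2 (by omega)
  rw [Finset.card_range] at this
  exact_mod_cast this

lemma rr_sum_le (M : ℕ) : ∑ k ∈ Finset.range M, rr k ≤ 2 * Real.sqrt M := by
  induction M with
  | zero => simp
  | succ m ih =>
    rw [Finset.sum_range_succ]
    push_cast
    have h : rr m ≤ 2 * (Real.sqrt (m + 1) - Real.sqrt m) := by
      unfold rr
      have h1 : 0 < Real.sqrt ((m:ℝ) + 1) := by positivity
      have h2 := Real.sq_sqrt (show (0:ℝ) ≤ (m:ℝ) + 1 by positivity)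
      have h3 := Real.sq_sqrt (show (0:ℝ) ≤ (m:ℝ) by positivity)
      rw [inv_le_iff_one_le_mul₀ h1]
      nlinarith [sq_nonneg (Real.sqrt ((m:ℝ)+1) - Real.sqrt m)]
    linarith

lemma one_le_log {N : ℕ} (hN : 3 ≤ N) : 1 ≤ Real.log N := by
  rw [Real.le_log_iff_exp_le (by positivity)]
  have : (3:ℝ) ≤ N := by exact_mod_cast hN
  linarith [Real.exp_one_lt_d9]

lemma hfun_ge {d N : ℕ} (hd : 3 ≤ d) (hN : 3 ≤ N) : (N:ℝ) ^ 4 ≤ hfun d N := by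
  have hN1 : (1:ℝ) ≤ N := by exact_mod_cast (by omega : 1 ≤ N)
  unfold hfun
  split_ifs with h3 h4
  · exact le_rfl
  · have := one_le_log hN
    have : 0 ≤ (N:ℝ) ^ 4 := by positivity
    nlinarith
  · exact pow_le_pow_right₀ hN1 (by omega)

lemma h_bound {d : ℕ} (hd : 3 ≤ d) (B : ℕ) : ∃ C : ℝ, 0 ≤ C ∧ ∀ N : ℕ, 3 ≤ N → ∀ M : ℕ, M ≤ B * N ^ 2 →
    (N:ℝ) ^ d * ∑ k ∈ Finset.range M, ((k:ℝ) + 1) * rr k ^ d ≤ C * hfun d N := by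
  have hr : ∀ k : ℕ, ((k:ℝ) + 1) * rr k ^ d = rr k ^ (d - 2) := by
    intro k
    have : d = 2 + (d - 2) := by omega
    rw [this, pow_add, rr_sq, ← mul_assoc, mul_inv_cancel₀ (by positivity), one_mul]
    congr 1; omega
  simp only [hr]
  rcases (by omega : d = 3 ∨ d = 4 ∨ 5 ≤ d) with rfl | rfl | h5
  · refine ⟨2 * Real.sqrt B, by positivity, fun N hN M hM => ?_⟩
    have h1 := rr_sum_le M
    have h2 : Real.sqrt M ≤ Real.sqrt B * N := by
      refine Real.sqrt_le_iff.2 ⟨by positivity, ?_⟩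
      rw [mul_pow, Real.sq_sqrt (by positivity)]
      exact_mod_cast hM
    simp only [hfun, if_true, pow_one]
    calc (N:ℝ) ^ 3 * ∑ k ∈ Finset.range M, rr k ^ (3 - 2) ≤ N ^ 3 * (2 * (Real.sqrt B * N)) := by
          gcongr
          simp only [Nat.reduceSub, pow_one]
          linarith
      _ = _ := by ring
  · refine ⟨3 + Real.log (B + 1), by have := Real.log_nonneg (show (1:ℝ) ≤ B + 1 by simp); positivity, fun N hN M hM => ?_⟩
    have hN1 : (1:ℝ) ≤ N := by exact_mod_cast (by omega : 1 ≤ N)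
    have hL := one_le_log hN
    have hB := Real.log_nonneg (show (1:ℝ) ≤ B + 1 by simp)
    have h1 : ∑ k ∈ Finset.range M, rr k ^ (4 - 2) = ((harmonic M : ℚ) : ℝ) := by
      simp only [Nat.reduceSub, rr_sq, harmonic]
      push_cast; rfl
    have h2 : Real.log M ≤ Real.log (B + 1) + 2 * Real.log N := by
      rcases Nat.eq_zero_or_pos M with rfl | hM0
      · simp; positivity
      · have : Real.log (B + 1) + 2 * Real.log N = Real.log ((B + 1) * N ^ 2) := by
          rw [Real.log_mul (by positivity) (by positivity), Real.log_pow]; norm_num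
        rw [this]
        refine Real.log_le_log (by exact_mod_cast hM0) ?_
        have : (M:ℝ) ≤ B * N ^ 2 := by exact_mod_cast hM
        nlinarith [sq_nonneg (N:ℝ)]
    have h3 := harmonic_le_one_add_log M
    have h4 : ∑ k ∈ Finset.range M, rr k ^ (4 - 2) ≤ (3 + Real.log (B + 1)) * Real.log N := by
      rw [h1]; nlinarith
    have h5 : hfun 4 N = N ^ 4 * Real.log N := by simp [hfun]
    rw [h5]
    calc (N:ℝ) ^ 4 * ∑ k ∈ Finset.range M, rr k ^ (4 - 2)
        ≤ N ^ 4 * ((3 + Real.log (B + 1)) * Real.log N) := by gcongr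
      _ = _ := by ring
  · refine ⟨∑' k, rr k ^ 3, tsum_nonneg fun k => by have := rr_pos k; positivity, fun N hN M hM => ?_⟩
    have h1 : hfun d N = N ^ d := by
      simp [hfun, show d ≠ 3 by omega, show d ≠ 4 by omega]
    rw [h1, mul_comm]
    gcongr
    refine le_trans (Finset.sum_le_sum fun k _ => pow_le_pow_of_le_one (rr_pos k).le (rr_le_one k)
      (show 3 ≤ d - 2 by omega)) ?_
    exact rr_summable.sum_le_tsum _ (fun k _ => by have := rr_pos k; positivity)

lemma gs_sq {d : ℕ} (hd : 1 ≤ d) (N : ℕ) [NeZero N] (hN : 3 ≤ N) (T : ℕ) (x : Fin d → ZMod N) :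
    ∑ y, gs (torus d N) T x y ^ 2
      = ∑ s ∈ Finset.range (T+1), ∑ t ∈ Finset.range (T+1), Kpow (torus d N) (s + t) 0 0 := by
  simp only [gs, sq, Finset.sum_mul_sum]
  rw [Finset.sum_comm]
  refine Finset.sum_congr rfl fun s _ => ?_
  rw [Finset.sum_comm]
  refine Finset.sum_congr rfl fun t _ => ?_
  rw [← Kpow_diag hd hN _ x, Kpow_add]
  exact Finset.sum_congr rfl fun z _ => by rw [Kpow_symm hd hN t x z]

lemma gs_sq_total {d : ℕ} (hd : 3 ≤ d) (B : ℕ) : ∃ C : ℝ, 0 ≤ C ∧ ∀ (N : ℕ) [NeZero N], 3 ≤ N →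
    ∀ T : ℕ, T ≤ B * N ^ 2 →
      ∑ x : Fin d → ZMod N, ∑ y, gs (torus d N) T x y ^ 2 ≤ C * hfun d N := by
  obtain ⟨C, hC, hheat⟩ := heat_diag (d := d) (by omega)
  obtain ⟨C1, hC1, hb⟩ := h_bound hd (2 * B + 2)
  refine ⟨C * C1 + C * (2 * B + 2) ^ 2, by positivity, ?_⟩
  intro N _ hN T hT
  have hN0 : (0:ℝ) < N := by exact_mod_cast (by omega : 0 < N)
  simp only [gs_sq (show 1 ≤ d by omega) N hN T]
  rw [Finset.sum_const, Finset.card_univ, nsmul_eq_mul]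
  have hcard : ((Fintype.card (Fin d → ZMod N) : ℕ) : ℝ) = N ^ d := by simp [ZMod.card]
  rw [hcard]
  have hM : 2 * (T + 1) ≤ (2 * B + 2) * N ^ 2 := by
    have : 1 ≤ N ^ 2 := Nat.one_le_pow _ _ (by omega)
    nlinarith
  have h1 := double_sum (fun k => Kpow (torus d N) k 0 0) (fun k => Kpow_nonneg _ k 0 0) (T + 1)
  have h2 := hb N hN (2 * (T+1)) hM
  generalize 2 * (T + 1) = M at h1 h2 hM
  have hM' : (M:ℝ) ≤ (2 * B + 2) * N ^ 2 := by exact_mod_cast hM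
  have h3 : ∑ k ∈ Finset.range M, ((k:ℝ) + 1) * Kpow (torus d N) k 0 0
      ≤ C * ∑ k ∈ Finset.range M, ((k:ℝ) + 1) * rr k ^ d + C * ((N:ℝ) ^ d)⁻¹ * (M:ℝ) ^ 2 := by
    have e : (M:ℝ) ^ 2 = ∑ k ∈ Finset.range M, (M:ℝ) := by simp [sq]
    rw [e, Finset.mul_sum, Finset.mul_sum, ← Finset.sum_add_distrib]
    refine Finset.sum_le_sum fun k hk => ?_
    have hk' : (k:ℝ) + 1 ≤ M := by exact_mod_cast Finset.mem_range.1 hk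
    calc ((k:ℝ) + 1) * Kpow (torus d N) k 0 0 ≤ (k + 1) * (C * (rr k ^ d + ((N:ℝ) ^ d)⁻¹)) := by
          gcongr; exact hheat N hN k
      _ = C * ((k + 1) * rr k ^ d) + C * ((N:ℝ) ^ d)⁻¹ * (k + 1) := by ring
      _ ≤ _ := by gcongr
  have h4 : (M:ℝ) ^ 2 ≤ (2 * B + 2) ^ 2 * hfun d N := by
    calc (M:ℝ) ^ 2 ≤ ((2 * B + 2) * N ^ 2) ^ 2 := by gcongr
      _ = (2 * B + 2) ^ 2 * (N:ℝ) ^ 4 := by ring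
      _ ≤ _ := by gcongr; exact hfun_ge hd hN
  calc (N:ℝ) ^ d * ∑ s ∈ Finset.range (T+1), ∑ t ∈ Finset.range (T+1), Kpow (torus d N) (s + t) 0 0
      ≤ N ^ d * (C * ∑ k ∈ Finset.range M, ((k:ℝ) + 1) * rr k ^ d + C * ((N:ℝ) ^ d)⁻¹ * (M:ℝ) ^ 2) := by
        gcongr; exact h1.trans h3
    _ = C * (N ^ d * ∑ k ∈ Finset.range M, ((k:ℝ) + 1) * rr k ^ d) + C * M ^ 2 := by
        field_simp
    _ ≤ C * (C1 * hfun d N) + C * ((2 * B + 2) ^ 2 * hfun d N) := by gcongr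
    _ = _ := by ring

lemma main_bound {d : ℕ} (hd : 3 ≤ d) (c : ℝ) (hc : 1 < c) : ∃ C : ℝ, 0 ≤ C ∧ ∀ ε : ℝ, 0 < ε → ε ≤ 1 →
    ∃ N0 : ℕ, ∀ (N : ℕ) [NeZero N], N0 ≤ N →
      (∑ x : Fin d → ZMod N, ∑ y : Fin d → ZMod N,
        (fnc (torus d N) c x y - (greenZ d 0)⁻¹ * greenC (torus d N) c x y) ^ 2) / hfun d N
      ≤ C * ε := by
  obtain ⟨B, hB⟩ := exists_nat_ge (c * (5 * d ^ 2))
  obtain ⟨C, hC, htot⟩ := gs_sq_total hd B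
  refine ⟨18 * C + 1, by positivity, ?_⟩
  intro ε hε hε1
  obtain ⟨S, N0, hclose⟩ := green_close hd B ε hε
  obtain ⟨Q, hQ⟩ := exists_nat_ge (50 * (S:ℝ) ^ 2 / ε)
  refine ⟨max 3 (max N0 Q), ?_⟩
  intro N _ hNN
  have hN : 3 ≤ N := le_trans (le_max_left _ _) hNN
  have hNN0 : N0 ≤ N := le_trans (le_trans (le_max_left _ _) (le_max_right _ _)) hNN
  have hNQ : Q ≤ N := le_trans (le_trans (le_max_right _ _) (le_max_right _ _)) hNN
  have hN0 : (0:ℝ) < N := by exact_mod_cast (by omega : 0 < N)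
  have hN1 : (1:ℝ) ≤ N := by exact_mod_cast (by omega : 1 ≤ N)
  obtain ⟨T, hT⟩ : ∃ T, T = ⌊c * (Tmix (torus d N) : ℝ)⌋₊ := ⟨_, rfl⟩
  have hTB : T ≤ B * N ^ 2 := by
    have h1 : (T:ℝ) ≤ c * (Tmix (torus d N) : ℝ) := hT ▸ Nat.floor_le (by positivity)
    have h2 : ((Tmix (torus d N) : ℕ) : ℝ) ≤ 5 * d ^ 2 * N ^ 2 := by
      exact_mod_cast tmix_le (d := d) (by omega) N hN
    have h3 : (T:ℝ) ≤ B * N ^ 2 := by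
      calc (T:ℝ) ≤ c * (5 * d ^ 2 * N ^ 2) := h1.trans (by gcongr)
        _ = (c * (5 * d ^ 2)) * N ^ 2 := by ring
        _ ≤ _ := by gcongr
    exact_mod_cast h3
  have hTm : Tmix (torus d N) ≤ T := by
    rw [hT]
    refine Nat.le_floor ?_
    have : (0:ℝ) ≤ Tmix (torus d N) := by positivity
    nlinarith
  obtain ⟨hS1, hS2⟩ := hclose N hN hNN0 T hTB
  have hdiag : ∀ (T : ℕ) (y : Fin d → ZMod N), gs (torus d N) T y y = gs (torus d N) T 0 0 := by
    intro T y
    exact Finset.sum_congr rfl fun t _ => Kpow_diag (by omega) hN t y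
  obtain ⟨u, hu⟩ : ∃ u, u = ((N:ℝ) ^ d)⁻¹ := ⟨_, rfl⟩
  have hu0 : 0 < u := by rw [hu]; positivity
  have hpt : ∀ x y : Fin d → ZMod N,
      (fnc (torus d N) c x y - (greenZ d 0)⁻¹ * greenC (torus d N) c x y) ^ 2
        ≤ 18 * ε ^ 2 * gs (torus d N) T x y ^ 2 + 50 * S ^ 2 * u ^ 2 := by
    intro x y
    have h1 := compare (torus d N) (K_row (by omega) hN) x y T S (greenZ d 0) ε (5 / 4 * u)
      (green_ge_one hd) hε.le hε1 (by rw [hdiag]; exact hS1) (by rw [hdiag]; exact hS2) (by positivity)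
      (fun t ht => by rw [hu]; exact after_mix (by omega) N hN t (hTm.trans ht) x y)
    have h2 : fnc (torus d N) c x y - (greenZ d 0)⁻¹ * greenC (torus d N) c x y
        = hitBy (torus d N) {y} x T - (greenZ d 0)⁻¹ * gs (torus d N) T x y := by
      rw [hT]; rfl
    rw [h2, ← sq_abs]
    calc _ ≤ (3 * ε * gs (torus d N) T x y + 4 * S * (5 / 4 * u)) ^ 2 := by gcongr
      _ ≤ _ := by nlinarith [sq_nonneg (3 * ε * gs (torus d N) T x y - 4 * S * (5 / 4 * u))]
  have hh := hfun_ge hd hN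
  have hN4 : (N:ℝ) ≤ (N:ℝ) ^ 4 := le_self_pow₀ hN1 (by norm_num)
  have hh0 : 0 < hfun d N := by linarith
  rw [div_le_iff₀ hh0]
  have hcard : ((Fintype.card (Fin d → ZMod N) : ℕ) : ℝ) = N ^ d := by simp [ZMod.card]
  have hsum : ∑ x : Fin d → ZMod N, ∑ y : Fin d → ZMod N,
      (18 * ε ^ 2 * gs (torus d N) T x y ^ 2 + 50 * S ^ 2 * u ^ 2)
      = 18 * ε ^ 2 * ∑ x : Fin d → ZMod N, ∑ y, gs (torus d N) T x y ^ 2 + 50 * S ^ 2 := by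
    simp only [Finset.sum_add_distrib, Finset.sum_const, Finset.card_univ, nsmul_eq_mul, hcard,
      ← Finset.mul_sum]
    congr 1
    rw [hu]; field_simp
  have hSN : 50 * (S:ℝ) ^ 2 ≤ ε * hfun d N := by
    rw [div_le_iff₀ hε] at hQ
    have : (Q:ℝ) ≤ N := by exact_mod_cast hNQ
    nlinarith
  have hε2 : ε ^ 2 ≤ ε := by nlinarith
  calc _ ≤ ∑ x : Fin d → ZMod N, ∑ y : Fin d → ZMod N,
      (18 * ε ^ 2 * gs (torus d N) T x y ^ 2 + 50 * S ^ 2 * u ^ 2) :=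
        Finset.sum_le_sum fun x _ => Finset.sum_le_sum fun y _ => hpt x y
    _ = 18 * ε ^ 2 * ∑ x : Fin d → ZMod N, ∑ y, gs (torus d N) T x y ^ 2 + 50 * S ^ 2 := hsum
    _ ≤ 18 * ε * (C * hfun d N) + ε * hfun d N := by
        gcongr
        exact htot N hN T hTB
    _ = _ := by ring

end last

/-- Lemma 5. For `d ≥ 3` and each `c > 1`,
`(1/h_d(n)) ∑_{x,y} (f_{n,c}(x,y) - G(0;ℤ^d)⁻¹ g_c(x,y;ℤ_n^d))² → 0`. -/
theorem fnc_green_comparison (d : ℕ) (hd : 3 ≤ d) :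
    ∀ c : ℝ, 1 < c →
      Tendsto (fun n =>
          (∑ x : Fin d → ZMod (n + 1), ∑ y : Fin d → ZMod (n + 1),
              (fnc (torus d (n + 1)) c x y
                - (greenZ d 0)⁻¹ * greenC (torus d (n + 1)) c x y) ^ 2)
            / hfun d (n + 1))
        atTop (nhds 0) := by
  intro c hc
  obtain ⟨C, hC, hmain⟩ := main_bound hd c hc
  rw [Metric.tendsto_atTop]
  intro δ hδ
  obtain ⟨N0, hN0⟩ := hmain (min 1 (δ / (2 * (C + 1)))) (lt_min one_pos (by positivity)) (min_le_left _ _)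
  refine ⟨N0 + 2, fun n hn => ?_⟩
  have h1 := hN0 (n + 1) (by omega)
  have h2 : C * min 1 (δ / (2 * (C + 1))) < δ := by
    calc C * min 1 (δ / (2 * (C + 1))) ≤ C * (δ / (2 * (C + 1))) := by gcongr; exact min_le_right _ _
      _ < δ := by
        rw [mul_div_assoc', div_lt_iff₀ (by positivity)]
        nlinarith
  have h3 : 0 ≤ hfun d (n + 1) := le_trans (by positivity) (hfun_ge hd (show 3 ≤ n + 1 by omega))
  rw [Real.dist_eq, sub_zero, abs_of_nonneg]
  · exact lt_of_le_of_lt h1 h2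
  · exact div_nonneg (Finset.sum_nonneg fun x _ => Finset.sum_nonneg fun y _ => sq_nonneg _) h3


end RWPaint
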